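/- Let W(Γ) be the right-angled Coxeter group of a finite simple graph Γ. If x and y generate a subgroup of W(Γ) isomorphic to ℤ × ℤ, then there exist generators x', y' of the same subgroup (or of another ℤ × ℤ subgroup of W(Γ)) given by reduced words x' = s₁⋯sₘ and y' = t₁⋯tₙ such that every letter tᵢ commutes with every letter sⱼ in W(Γ). -/

import Mathlib

/-- Relations of the right-angled Coxeter group on generating set `S` with
commutation relations given by `adj`. -/
def racgRels {S : Type} (adj : S → S → Prop) : Set (FreeGroup S) :=
  {w | (∃ s : S, w = FreeGroup.of s ^ 2) ∨
    ∃ s t : S, adj s t ∧ w = (FreeGroup.of s * FreeGroup.of t) ^ 2}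

/-- The right-angled Coxeter group associated to the adjacency relation `adj`. -/
def RACG {S : Type} (adj : S → S → Prop) : Type := PresentedGroup (racgRels adj)

instance {S : Type} (adj : S → S → Prop) : Group (RACG adj) :=
  inferInstanceAs (Group (PresentedGroup _))

/-- The generator of the right-angled Coxeter group corresponding to `s`. -/
def racgGen {S : Type} (adj : S → S → Prop) (s : S) : RACG adj := PresentedGroup.of s

/-- The element of the right-angled Coxeter group represented by a word. -/
def wordProd {S : Type} (adj : S → S → Prop) (l : List S) : RACG adj :=
  (l.map (racgGen adj)).prod

/-- The word length of an element of a right-angled Coxeter group. -/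
noncomputable def racgLength {S : Type} (adj : S → S → Prop) (x : RACG adj) : ℕ :=
  sInf {n | ∃ l : List S, l.length = n ∧ wordProd adj l = x}


/-- A pair of group elements that generates a free abelian group of rank two, provided that the two
elements commute. -/
def IsIndepPair {G : Type*} [Group G] (x y : G) : Prop :=
  ∀ a b : ℤ, x ^ a * y ^ b = 1 → a = 0 ∧ b = 0

namespace IsIndepPair

variable {G : Type*} [Group G] {x y : G}

lemma left_ne_one (h : IsIndepPair x y) : x ≠ 1 := by
  rintro rfl
  simpa using h 1 0 (by simp)

lemma symm (hc : Commute x y) (h : IsIndepPair x y) : IsIndepPair y x := fun a b hab ↦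
  (h b a (by rw [(hc.zpow_zpow b a).eq, hab])).symm

lemma pow (h : IsIndepPair x y) {m n : ℕ} (hm : m ≠ 0) (hn : n ≠ 0) :
    IsIndepPair (x ^ m) (y ^ n) := by
  intro a b hab
  have := h (m * a) (n * b) (by rw [zpow_mul, zpow_mul, zpow_natCast, zpow_natCast, hab])
  simpa [hm, hn] using this

lemma not_isOfFinOrder_left (h : IsIndepPair x y) : ¬ IsOfFinOrder x := by
  rw [isOfFinOrder_iff_pow_eq_one]
  rintro ⟨n, hn, hx⟩
  have := (h n 0 (by simp [hx])).1
  omega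

lemma mul_zpow_left (hc : Commute x y) (h : IsIndepPair x y) {a : ℤ} (ha : a ≠ 0) (b : ℤ) :
    IsIndepPair (x ^ a * y ^ b) y := by
  intro m n hmn
  rw [(hc.zpow_zpow a b).mul_zpow, mul_assoc, ← zpow_mul, ← zpow_mul, ← zpow_add] at hmn
  have := h _ _ hmn
  have hm : m = 0 := by simpa [ha] using this.1
  subst hm
  simpa using this.2

end IsIndepPair

lemma not_isOfFinOrder_conj_pow {G : Type*} [Group G] {x : G} (hx : ¬ IsOfFinOrder x) {n : ℕ}
    (hn : n ≠ 0) (c : G) : ¬ IsOfFinOrder (c⁻¹ * x ^ n * c) := fun h ↦ hx <| by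
  have := (MulAut.conj c).toMonoidHom.isOfFinOrder h
  rw [show (MulAut.conj c).toMonoidHom (c⁻¹ * x ^ n * c) = x ^ n by simp; group] at this
  exact this.of_pow hn

namespace FreeGroup

variable {α : Type*}

lemma eq_of_commute_of {a b : α} (h : Commute (of a) (of b)) : a = b := by
  classical
  by_contra hab
  let f : FreeGroup α →* Equiv.Perm (Fin 3) :=
    lift fun i ↦ if i = a then Equiv.swap 0 1 else Equiv.swap 1 2
  have hf := h.map f
  simp only [f, lift_apply_of, if_true, if_neg (Ne.symm hab)] at hf
  exact absurd hf.eq (by decide)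

/-- Commuting elements of a free group are powers of a common element. -/
lemma exists_zpow_eq_of_commute {f g : FreeGroup α} (h : Commute f g) :
    ∃ (c : FreeGroup α) (m n : ℤ), f = c ^ m ∧ g = c ^ n := by
  let H : Subgroup (FreeGroup α) := Subgroup.closure {f, g}
  have hcomm : ∀ a b : H, a * b = b * a := by
    have : IsMulCommutative H := Subgroup.isMulCommutative_closure (by
      rintro x (rfl | rfl) y (rfl | rfl)
      exacts [rfl, h.eq, h.eq.symm, rfl])
    exact fun a b ↦ mul_comm' a b
  let e := IsFreeGroup.toFreeGroup H
  have hsub : Subsingleton (IsFreeGroup.Generators H) := ⟨fun a b ↦ eq_of_commute_of <| by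
    have := congrArg e (hcomm (e.symm (of a)) (e.symm (of b)))
    rwa [_root_.map_mul, _root_.map_mul, e.apply_symm_apply, e.apply_symm_apply] at this⟩
  have hcyc : IsCyclic (FreeGroup (IsFreeGroup.Generators H)) := by
    rcases isEmpty_or_nonempty (IsFreeGroup.Generators H) with hE | ⟨⟨i⟩⟩
    · infer_instance
    · have := uniqueOfSubsingleton i
      infer_instance
  obtain ⟨c, hc⟩ := hcyc.exists_generator
  obtain ⟨m, hm⟩ := hc (e ⟨f, Subgroup.subset_closure (by simp)⟩)
  obtain ⟨n, hn⟩ := hc (e ⟨g, Subgroup.subset_closure (by simp)⟩)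
  refine ⟨e.symm c, m, n, ?_, ?_⟩
  · have := congrArg e.symm hm
    simp only [map_zpow, MulEquiv.symm_apply_apply] at this
    simpa using (congrArg Subtype.val this).symm
  · have := congrArg e.symm hn
    simp only [map_zpow, MulEquiv.symm_apply_apply] at this
    simpa using (congrArg Subtype.val this).symm

lemma not_isIndepPair_of_commute {f g : FreeGroup α} (h : Commute f g) : ¬ IsIndepPair f g := by
  intro hi
  obtain ⟨c, m, n, rfl, rfl⟩ := exists_zpow_eq_of_commute h
  obtain ⟨rfl, -⟩ := hi n (-m) (by rw [← zpow_mul, ← zpow_mul, ← zpow_add]; simp [mul_comm])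
  exact (hi.symm h).left_ne_one (zpow_zero c)

open Classical in
/-- The endomorphism of a free group that kills the free generators outside `J`. -/
noncomputable def retract (J : Set α) : FreeGroup α →* FreeGroup α :=
  lift fun i ↦ if i ∈ J then of i else 1

lemma retract_retract (J K : Set α) (f : FreeGroup α) :
    retract J (retract K f) = retract (J ∩ K) f := by
  suffices (retract J).comp (retract K) = retract (J ∩ K) from DFunLike.congr_fun this f
  ext i
  by_cases hK : i ∈ K <;> by_cases hJ : i ∈ J <;> simp [retract, hK, hJ]

lemma retract_empty (f : FreeGroup α) : retract ∅ f = 1 := by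
  suffices retract ∅ = (1 : FreeGroup α →* FreeGroup α) from DFunLike.congr_fun this f
  ext i
  simp [retract]

lemma retract_singleton_mem_zpowers (i : α) (f : FreeGroup α) :
    retract {i} f ∈ Subgroup.zpowers (of i) := by
  induction f using FreeGroup.induction_on with
  | C1 => simp
  | of j => by_cases hj : j = i <;> simp [retract, hj]
  | inv_of j hj => simpa using hj
  | mul f g hf hg => simpa using mul_mem hf hg

lemma map_retract (π : Equiv.Perm α) (J : Set α) (f : FreeGroup α) :
    map π (retract J f) = retract (π '' J) (map π f) := by
  suffices (map π).comp (retract J) = (retract (π '' J)).comp (map π) from DFunLike.congr_fun this f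
  ext i
  by_cases hJ : i ∈ J <;> simp [retract, hJ]

lemma exists_finset_retract_eq (f : FreeGroup α) : ∃ J : Finset α, retract (J : Set α) f = f := by
  classical
  have mono : ∀ {f : FreeGroup α} {J K : Finset α}, J ⊆ K → retract (J : Set α) f = f →
      retract (K : Set α) f = f := fun {f J K} hJK hJ ↦ by
    rw [← hJ, retract_retract, Set.inter_eq_right.2 (by exact_mod_cast hJK)]
  induction f using FreeGroup.induction_on with
  | C1 => exact ⟨∅, _root_.map_one _⟩
  | of i => exact ⟨{i}, by simp [retract]⟩
  | inv_of i h =>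
    obtain ⟨J, hJ⟩ := h
    exact ⟨J, by rw [_root_.map_inv, hJ]⟩
  | mul f g hf hg =>
    obtain ⟨J, hJ⟩ := hf
    obtain ⟨K, hK⟩ := hg
    exact ⟨J ∪ K, by
      rw [_root_.map_mul, mono Finset.subset_union_left hJ, mono Finset.subset_union_right hK]⟩

/-- If a permutation of the free generators sends `f` to a conjugate of `f`, then some power of it
fixes all generators occurring in a suitable conjugate of `f`. -/
lemma exists_pow_fixes_of_isConj (f : FreeGroup α) (π : Equiv.Perm α) (hf : IsConj (map π f) f) :
    ∃ (J : Finset α) (N : ℕ) (c : FreeGroup α), 0 < N ∧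
      retract (J : Set α) (c * f * c⁻¹) = c * f * c⁻¹ ∧ ∀ i ∈ J, (π ^ N) i = i := by
  classical
  let C : Finset α → Prop := fun J ↦ ∃ g, IsConj f g ∧ retract (J : Set α) g = g
  have hC : ∃ J, C J := (exists_finset_retract_eq f).imp fun J hJ ↦ ⟨f, IsConj.refl f, hJ⟩
  have hinter : ∀ J K, C J → C K → C (J ∩ K) := by
    rintro J K ⟨g, hg, hgJ⟩ ⟨k, hk, hkK⟩
    refine ⟨retract (K : Set α) g, ?_, ?_⟩
    · have := (retract (K : Set α)).map_isConj (hk.symm.trans hg)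
      rw [hkK] at this
      exact hk.trans this
    · nth_rw 1 [← hgJ]
      rw [retract_retract, retract_retract, Finset.coe_inter]
      conv_rhs => rw [← hgJ, retract_retract]
      congr 1
      congr 1
      ext; simp; tauto
  have hmap : ∀ J, C J → C (J.map π.toEmbedding) := by
    rintro J ⟨g, hg, hgJ⟩
    refine ⟨map π g, hf.symm.trans ((map π).map_isConj hg), ?_⟩
    rw [Finset.coe_map]
    conv_rhs => rw [← hgJ, map_retract]
    rfl
  obtain ⟨J, hJ, hmin⟩ := exists_minimalFor_of_wellFoundedLT C Finset.card hC
  have hπJ : J.map π.toEmbedding = J := by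
    have h1 := hinter _ _ hJ (hmap J hJ)
    have h2 := hmin h1 (Finset.card_le_card Finset.inter_subset_left)
    have h3 : J ∩ J.map π.toEmbedding = J := Finset.eq_of_subset_of_card_le
      Finset.inter_subset_left h2
    exact (Finset.eq_of_subset_of_card_le (Finset.inter_eq_left.1 h3) (by simp)).symm
  have hmem : ∀ i, π i ∈ J ↔ i ∈ J := fun i ↦ by
    conv_lhs => rw [← hπJ]
    simp
  let τ : Equiv.Perm J := π.subtypePerm hmem
  obtain ⟨g, hg, hgJ⟩ := hJ
  obtain ⟨c, rfl⟩ := isConj_iff.1 hg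
  refine ⟨J, orderOf τ, c, orderOf_pos τ, hgJ, fun i hi ↦ ?_⟩
  have h1 : (τ ^ orderOf τ) ⟨i, hi⟩ = ⟨i, hi⟩ := by rw [pow_orderOf_eq_one]; rfl
  rw [Equiv.Perm.subtypePerm_pow] at h1
  simpa using congrArg Subtype.val h1

/-- The automorphism of a free group sending each free generator to its inverse. -/
def invGen (α : Type*) : MulAut (FreeGroup α) :=
  MonoidHom.toMulEquiv (lift fun i ↦ (of i)⁻¹) (lift fun i ↦ (of i)⁻¹) (by ext; simp) (by ext; simp)

@[simp] lemma invGen_of (i : α) : invGen α (of i) = (of i)⁻¹ := by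
  simp [invGen]

lemma mulAut_ext {φ ψ : MulAut (FreeGroup α)} (h : ∀ i, φ (of i) = ψ (of i)) : φ = ψ :=
  MulEquiv.toMonoidHom_injective (ext_hom _ _ h)

/-- Signed permutations act on a free group: permutations permute the free generators and `-1`
inverts them. -/
def signedPermAut (α : Type*) : Equiv.Perm α × ℤˣ →* MulAut (FreeGroup α) :=
  MonoidHom.noncommCoprod
    { toFun := fun π ↦ freeGroupCongr π
      map_one' := mulAut_ext fun i ↦ by simp
      map_mul' := fun π τ ↦ mulAut_ext fun i ↦ by simp }
    { toFun := fun ε ↦ if ε = 1 then 1 else invGen α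
      map_one' := by simp
      map_mul' := fun ε δ ↦ by
        have : invGen α * invGen α = 1 := mulAut_ext fun i ↦ by simp
        rcases Int.units_eq_one_or ε with rfl | rfl <;>
          rcases Int.units_eq_one_or δ with rfl | rfl <;> simp [this] }
    (fun π ε ↦ by
      rcases Int.units_eq_one_or ε with rfl | rfl
      · simp
      · change freeGroupCongr π * _ = _ * freeGroupCongr π
        exact mulAut_ext fun i ↦ by simp)

lemma signedPermAut_one (π : Equiv.Perm α) (f : FreeGroup α) :
    signedPermAut α (π, 1) f = map π f := by
  simp [signedPermAut]

lemma signedPermAut_neg_one_of (π : Equiv.Perm α) (i : α) :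
    signedPermAut α (π, -1) (of i) = (of (π i))⁻¹ := by
  simp [signedPermAut]

end FreeGroup

namespace RACG

section Basic

variable {S : Type} {adj : S → S → Prop}

lemma gen_mul_self (s : S) : racgGen adj s * racgGen adj s = 1 := by
  have h : PresentedGroup.mk (racgRels adj) (FreeGroup.of s ^ 2) = 1 :=
    PresentedGroup.one_of_mem (Or.inl ⟨s, rfl⟩)
  rw [pow_two] at h
  exact h

lemma gen_inv (s : S) : (racgGen adj s)⁻¹ = racgGen adj s :=
  inv_eq_of_mul_eq_one_left (gen_mul_self s)

lemma gen_commute {s t : S} (hst : adj s t) : Commute (racgGen adj s) (racgGen adj t) := by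
  have h : PresentedGroup.mk (racgRels adj) ((FreeGroup.of s * FreeGroup.of t) ^ 2) = 1 :=
    PresentedGroup.one_of_mem (Or.inr ⟨s, t, hst, rfl⟩)
  rw [pow_two] at h
  have h' : (racgGen adj s * racgGen adj t) * (racgGen adj s * racgGen adj t) = 1 := h
  have h_inv := inv_eq_of_mul_eq_one_left h'
  rw [mul_inv_rev, gen_inv, gen_inv] at h_inv
  exact h_inv.symm

/-- The universal property of a right-angled Coxeter group. -/
def lift {G : Type*} [Group G] (f : S → G) (hsq : ∀ s, f s * f s = 1)
    (hcomm : ∀ s t, adj s t → Commute (f s) (f t)) : RACG adj →* G :=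
  PresentedGroup.toGroup (f := f) (by
    rintro r (⟨s, rfl⟩ | ⟨s, t, hst, rfl⟩)
    · simp [pow_two, hsq]
    · simp only [map_pow, map_mul, FreeGroup.lift_apply_of]
      rw [(hcomm s t hst).mul_pow, pow_two, pow_two, hsq, hsq, one_mul])

@[simp] lemma lift_gen {G : Type*} [Group G] (f : S → G) (hsq : ∀ s, f s * f s = 1)
    (hcomm : ∀ s t, adj s t → Commute (f s) (f t)) (s : S) :
    lift f hsq hcomm (racgGen adj s) = f s :=
  PresentedGroup.toGroup.of _

lemma hom_ext {G : Type*} [Group G] {φ ψ : RACG adj →* G}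
    (h : ∀ s, φ (racgGen adj s) = ψ (racgGen adj s)) : φ = ψ :=
  PresentedGroup.ext h

lemma induction_gen {P : RACG adj → Prop} (one : P 1)
    (gen_mul : ∀ s x, P x → P (racgGen adj s * x)) (x : RACG adj) : P x := by
  have hx : x ∈ Subgroup.closure (Set.range (racgGen adj)) := by
    have : Subgroup.closure (Set.range (racgGen adj)) = ⊤ :=
      PresentedGroup.closure_range_of (racgRels adj)
    simp [this]
  induction hx using Subgroup.closure_induction_left with
  | one => exact one
  | mul_left s hs y _ hy =>
    obtain ⟨s, rfl⟩ := hs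
    exact gen_mul s y hy
  | inv_mul_cancel s hs y _ hy =>
    obtain ⟨s, rfl⟩ := hs
    rw [gen_inv]
    exact gen_mul s y hy

open Classical in
/-- The retraction of a right-angled Coxeter group onto a standard parabolic subgroup, killing the
generators outside `J`. -/
noncomputable def retract (J : Set S) : RACG adj →* RACG adj :=
  lift (fun s ↦ if s ∈ J then racgGen adj s else 1)
    (fun s ↦ by by_cases h : s ∈ J <;> simp [h, gen_mul_self])
    (fun s t hst ↦ by
      by_cases hs : s ∈ J <;> by_cases ht : t ∈ J <;> simp [hs, ht, gen_commute hst])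

lemma retract_gen_of_mem {J : Set S} {s : S} (h : s ∈ J) :
    retract J (racgGen adj s) = racgGen adj s := by
  simp [retract, h]

lemma retract_gen_of_notMem {J : Set S} {s : S} (h : s ∉ J) : retract J (racgGen adj s) = 1 := by
  simp [retract, h]

lemma retract_retract (J K : Set S) (x : RACG adj) :
    retract J (retract K x) = retract (J ∩ K) x := by
  suffices (retract J).comp (retract K) = retract (adj := adj) (J ∩ K) from
    DFunLike.congr_fun this x
  refine hom_ext fun s ↦ ?_
  by_cases hK : s ∈ K <;> by_cases hJ : s ∈ J <;> simp [retract, hK, hJ]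

variable (adj) in
/-- The standard parabolic subgroup generated by `J`, as the fixed points of its retraction. -/
noncomputable def parabolic (J : Set S) : Subgroup (RACG adj) :=
  (retract J).eqLocus (MonoidHom.id _)

lemma mem_parabolic {J : Set S} {x : RACG adj} : x ∈ parabolic adj J ↔ retract J x = x := Iff.rfl

lemma retract_mem_parabolic (J : Set S) (x : RACG adj) : retract J x ∈ parabolic adj J := by
  rw [mem_parabolic, retract_retract, Set.inter_self]

lemma gen_mem_parabolic {J : Set S} {s : S} (h : s ∈ J) : racgGen adj s ∈ parabolic adj J :=
  retract_gen_of_mem h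

lemma parabolic_mono {J K : Set S} (h : J ⊆ K) : parabolic adj J ≤ parabolic adj K := by
  intro x hx
  rw [mem_parabolic] at hx ⊢
  rw [← hx, retract_retract, Set.inter_eq_right.2 h]

lemma mem_parabolic_univ (x : RACG adj) : x ∈ parabolic adj Set.univ := by
  rw [mem_parabolic]
  suffices retract Set.univ = MonoidHom.id (RACG adj) from DFunLike.congr_fun this x
  exact hom_ext fun s ↦ retract_gen_of_mem (Set.mem_univ s)

lemma retract_mem_inter {J K : Set S} {x : RACG adj} (hx : x ∈ parabolic adj K) :
    retract J x ∈ parabolic adj (J ∩ K) := by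
  rw [← mem_parabolic.1 hx, retract_retract]
  exact retract_mem_parabolic _ _

lemma mem_parabolic_empty {x : RACG adj} (hx : x ∈ parabolic adj ∅) : x = 1 := by
  rw [mem_parabolic] at hx
  rw [← hx]
  suffices retract ∅ = (1 : RACG adj →* RACG adj) from DFunLike.congr_fun this x
  exact hom_ext fun s ↦ retract_gen_of_notMem (Set.notMem_empty s)

lemma parabolic_induction {J : Set S} {P : RACG adj → Prop} (one : P 1)
    (gen_mul : ∀ s ∈ J, ∀ x ∈ parabolic adj J, P x → P (racgGen adj s * x)) {x : RACG adj}
    (hx : x ∈ parabolic adj J) : P x := by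
  suffices ∀ y, P (retract J y) by simpa only [mem_parabolic.1 hx] using this x
  intro y
  induction y using induction_gen with
  | one => simpa using one
  | gen_mul t y ih =>
    by_cases ht : t ∈ J
    · rw [map_mul, retract_gen_of_mem ht]
      exact gen_mul t ht _ (retract_mem_parabolic J y) ih
    · rwa [map_mul, retract_gen_of_notMem ht, one_mul]

lemma commute_gen_of_mem_parabolic {J : Set S} {s : S} (hJ : ∀ t ∈ J, s ≠ t → adj s t)
    {x : RACG adj} (hx : x ∈ parabolic adj J) : Commute (racgGen adj s) x := by
  refine parabolic_induction (Commute.one_right _) (fun t ht y _ hy ↦ ?_) hx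
  refine Commute.mul_right ?_ hy
  by_cases hst : s = t
  · exact hst ▸ Commute.refl _
  · exact gen_commute (hJ t ht hst)

lemma exists_not_adj_of_not_isOfFinOrder {J : Set S} {x : RACG adj} (hx : x ∈ parabolic adj J)
    (hinf : ¬ IsOfFinOrder x) : ∃ p ∈ J, ∃ q ∈ J, p ≠ q ∧ ¬ adj p q := by
  by_contra! hJ
  refine hinf (isOfFinOrder_iff_pow_eq_one.2 ⟨2, two_pos, ?_⟩)
  refine parabolic_induction (P := fun y ↦ y ^ 2 = 1) (one_pow 2) (fun t ht y hy hy2 ↦ ?_) hx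
  rw [(commute_gen_of_mem_parabolic (hJ t ht) hy).mul_pow, hy2, pow_two, gen_mul_self, one_mul]

end Basic

section Splitting

variable {V : Type} (Γ : SimpleGraph V) (v : V)

/-- The preimage of the parabolic subgroup of the link of `v` under the retraction killing `v`. -/
noncomputable def linkPreimage : Subgroup (RACG Γ.Adj) :=
  (parabolic Γ.Adj (Γ.neighborSet v)).comap (retract {v}ᶜ)

/-- The action on the free group over the cosets of `linkPreimage Γ v`, where the sign inverts the
free generators. -/
noncomputable def cosetAut :
    RACG Γ.Adj × ℤˣ →* MulAut (FreeGroup (RACG Γ.Adj ⧸ linkPreimage Γ v)) :=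
  (FreeGroup.signedPermAut _).comp
    (MonoidHom.prodMap (MulAction.toPermHom (RACG Γ.Adj) (RACG Γ.Adj ⧸ linkPreimage Γ v))
      (MonoidHom.id ℤˣ))

variable {Γ v}

lemma cosetAut_one (h : RACG Γ.Adj) (f : FreeGroup (RACG Γ.Adj ⧸ linkPreimage Γ v)) :
    cosetAut Γ v (h, 1) f = FreeGroup.map (MulAction.toPerm h) f :=
  FreeGroup.signedPermAut_one _ f

lemma cosetAut_neg_one_of (h : RACG Γ.Adj) (i : RACG Γ.Adj ⧸ linkPreimage Γ v) :
    cosetAut Γ v (h, -1) (.of i) = (.of (h • i))⁻¹ :=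
  FreeGroup.signedPermAut_neg_one_of _ i

lemma mem_linkPreimage {x : RACG Γ.Adj} :
    x ∈ linkPreimage Γ v ↔ retract {v}ᶜ x ∈ parabolic Γ.Adj (Γ.neighborSet v) := Iff.rfl

lemma neighborSet_subset_compl : Γ.neighborSet v ⊆ {v}ᶜ := by
  rintro s hs rfl
  exact Γ.loopless.irrefl _ hs

lemma smul_one_coset {s : V} (hs : s ∈ Γ.neighborSet v) :
    racgGen Γ.Adj s • ((1 : RACG Γ.Adj) : RACG Γ.Adj ⧸ linkPreimage Γ v) = (1 : RACG Γ.Adj) := by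
  rw [MulAction.Quotient.smul_coe, smul_eq_mul, mul_one, QuotientGroup.eq, mul_one, inv_mem_iff,
    mem_linkPreimage, retract_gen_of_mem (neighborSet_subset_compl hs)]
  exact gen_mem_parabolic hs

variable (Γ v) in
open Classical in
/-- The splitting of a right-angled Coxeter group along the vertex `v`: the kernel of the retraction
killing `v` becomes, up to signs, a free group. -/
noncomputable def split : RACG Γ.Adj →*
    FreeGroup (RACG Γ.Adj ⧸ linkPreimage Γ v) ⋊[cosetAut Γ v] (RACG Γ.Adj × ℤˣ) :=
  lift (fun s ↦ if s = v then ⟨.of ((1 : RACG Γ.Adj) : RACG Γ.Adj ⧸ linkPreimage Γ v), (1, -1)⟩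
      else SemidirectProduct.inr (racgGen Γ.Adj s, 1))
    (fun s ↦ by
      by_cases hs : s = v
      · simp only [hs, if_true]
        ext
        · simp [cosetAut_neg_one_of]
        · simp
        · simp
      · simp only [hs, if_false, ← map_mul, Prod.mk_mul_mk, gen_mul_self, mul_one]
        rfl)
    (by
      have key : ∀ t ∈ Γ.neighborSet v, Commute
          (⟨.of ((1 : RACG Γ.Adj) : RACG Γ.Adj ⧸ linkPreimage Γ v), (1, -1)⟩ :
            FreeGroup (RACG Γ.Adj ⧸ linkPreimage Γ v) ⋊[cosetAut Γ v] (RACG Γ.Adj × ℤˣ))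
          (SemidirectProduct.inr (racgGen Γ.Adj t, 1)) := by
        intro t ht
        ext
        · simp [cosetAut_one, smul_one_coset ht]
        · simp
        · simp
      intro s t hst
      by_cases hs : s = v <;> by_cases ht : t = v
      · subst hs ht; exact absurd hst (Γ.loopless.irrefl _)
      · subst hs
        simpa [ht] using key t hst
      · subst ht
        simpa [hs] using (key s hst.symm).symm
      · simp only [hs, ht, if_false]
        have : Commute (racgGen Γ.Adj s, (1 : ℤˣ)) (racgGen Γ.Adj t, 1) :=
          Commute.prod (gen_commute hst) (Commute.one_left _)
        exact this.map SemidirectProduct.inr)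

lemma split_gen_self :
    split Γ v (racgGen Γ.Adj v) =
      ⟨.of ((1 : RACG Γ.Adj) : RACG Γ.Adj ⧸ linkPreimage Γ v), (1, -1)⟩ := by
  simp [split]

lemma split_gen_of_ne {s : V} (hs : s ≠ v) :
    split Γ v (racgGen Γ.Adj s) = SemidirectProduct.inr (racgGen Γ.Adj s, 1) := by
  simp [split, hs]

lemma split_right_fst (x : RACG Γ.Adj) : (split Γ v x).right.1 = retract {v}ᶜ x := by
  suffices ((MonoidHom.fst _ _).comp SemidirectProduct.rightHom).comp (split Γ v) =
    retract {v}ᶜ from DFunLike.congr_fun this x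
  refine hom_ext fun s ↦ ?_
  by_cases hs : s = v
  · subst hs
    simp [split_gen_self, retract_gen_of_notMem]
  · simp [split_gen_of_ne hs, retract_gen_of_mem (show s ∈ ({v}ᶜ : Set V) from hs)]

lemma split_of_mem_parabolic {x : RACG Γ.Adj} (hx : x ∈ parabolic Γ.Adj {v}ᶜ) :
    split Γ v x = SemidirectProduct.inr (x, 1) := by
  refine parabolic_induction (P := fun y ↦ split Γ v y = SemidirectProduct.inr (y, 1))
    (map_one _) (fun s hs y _ hy ↦ ?_) hx
  rw [map_mul, split_gen_of_ne hs, hy, ← map_mul, Prod.mk_mul_mk, mul_one]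

variable (Γ v) in
/-- The map from the free group over the cosets of `linkPreimage Γ v` sending each coset to the
corresponding conjugate of `v`. -/
noncomputable def conjHom : FreeGroup (RACG Γ.Adj ⧸ linkPreimage Γ v) →* RACG Γ.Adj :=
  FreeGroup.lift fun i ↦
    retract {v}ᶜ i.out * racgGen Γ.Adj v * (retract {v}ᶜ i.out)⁻¹

lemma conjHom_of_coe (g : RACG Γ.Adj) :
    conjHom Γ v (.of (g : RACG Γ.Adj ⧸ linkPreimage Γ v)) =
      retract {v}ᶜ g * racgGen Γ.Adj v * (retract {v}ᶜ g)⁻¹ := by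
  obtain ⟨⟨k, hk⟩, hout⟩ := QuotientGroup.mk_out_eq_mul (linkPreimage Γ v) g
  have hcomm : Commute (racgGen Γ.Adj v) (retract {v}ᶜ k) :=
    commute_gen_of_mem_parabolic (fun t ht _ ↦ ht) (mem_linkPreimage.1 hk)
  simp only [conjHom, FreeGroup.lift_apply_of, hout, map_mul, mul_inv_rev]
  rw [mul_assoc (retract {v}ᶜ g), ← hcomm.eq]
  group

lemma conjHom_of_mul_self (i : RACG Γ.Adj ⧸ linkPreimage Γ v) :
    conjHom Γ v (.of i) * conjHom Γ v (.of i) = 1 := by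
  simp only [conjHom, FreeGroup.lift_apply_of]
  rw [show ∀ a b : RACG Γ.Adj, a * b * a⁻¹ * (a * b * a⁻¹) = a * (b * b) * a⁻¹ by
    intros; group, gen_mul_self, mul_one, mul_inv_cancel]

variable (Γ v) in
/-- A left inverse of `split`. -/
noncomputable def unsplit :
    FreeGroup (RACG Γ.Adj ⧸ linkPreimage Γ v) ⋊[cosetAut Γ v] (RACG Γ.Adj × ℤˣ) →* RACG Γ.Adj :=
  SemidirectProduct.lift (conjHom Γ v) ((retract {v}ᶜ).comp (MonoidHom.fst _ _)) (by
    rintro ⟨h, ε⟩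
    refine FreeGroup.ext_hom _ _ fun i ↦ ?_
    have hi : conjHom Γ v (.of (h • i)) =
        retract {v}ᶜ h * conjHom Γ v (.of i) * (retract {v}ᶜ h)⁻¹ := by
      induction i using QuotientGroup.induction_on with
      | H g =>
        rw [MulAction.Quotient.smul_coe, conjHom_of_coe, conjHom_of_coe, smul_eq_mul, map_mul]
        group
    rcases Int.units_eq_one_or ε with rfl | rfl
    · simp [cosetAut_one, hi]
    · simp only [MonoidHom.comp_apply, MulEquiv.coe_toMonoidHom, cosetAut_neg_one_of, map_inv,
        MulAut.conj_apply, MonoidHom.coe_fst]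
      rw [inv_eq_of_mul_eq_one_left (conjHom_of_mul_self _), hi])

lemma unsplit_split (x : RACG Γ.Adj) : unsplit Γ v (split Γ v x) = x := by
  suffices (unsplit Γ v).comp (split Γ v) = MonoidHom.id _ from DFunLike.congr_fun this x
  refine hom_ext fun s ↦ ?_
  by_cases hs : s = v
  · subst hs
    simp [split_gen_self, unsplit, SemidirectProduct.mk_eq_inl_mul_inr, conjHom_of_coe]
  · simp [split_gen_of_ne hs, unsplit, retract_gen_of_mem (show s ∈ ({v}ᶜ : Set V) from hs)]

lemma split_injective : Function.Injective (split Γ v) :=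
  Function.LeftInverse.injective unsplit_split

lemma conj_mem_parabolic_of_smul_eq {h a : RACG Γ.Adj} (hh : h ∈ parabolic Γ.Adj {v}ᶜ)
    (ha : h • (a : RACG Γ.Adj ⧸ linkPreimage Γ v) = a) :
    (retract {v}ᶜ a)⁻¹ * h * retract {v}ᶜ a ∈ parabolic Γ.Adj (Γ.neighborSet v) := by
  rw [MulAction.Quotient.smul_coe, eq_comm, QuotientGroup.eq, mem_linkPreimage, smul_eq_mul,
    map_mul, map_mul, map_inv, mem_parabolic.1 hh, ← mul_assoc] at ha
  exact ha

lemma conjHom_retract_mul_self {J : Finset (RACG Γ.Adj ⧸ linkPreimage Γ v)} (hJ : J.card ≤ 1)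
    (f : FreeGroup (RACG Γ.Adj ⧸ linkPreimage Γ v)) :
    conjHom Γ v (FreeGroup.retract (J : Set _) f) ^ 2 = 1 := by
  rcases J.eq_empty_or_nonempty with rfl | hne
  · simp [FreeGroup.retract_empty]
  · obtain ⟨i, rfl⟩ := Finset.card_eq_one.1 (le_antisymm hJ hne.card_pos)
    obtain ⟨n, hn⟩ := FreeGroup.retract_singleton_mem_zpowers i f
    simp only at hn
    rw [Finset.coe_singleton, ← hn, map_zpow, ← zpow_natCast, zpow_comm, zpow_natCast, pow_two,
      conjHom_of_mul_self, one_zpow]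

end Splitting

section Square

variable {V : Type} {Γ : SimpleGraph V}

lemma exists_link_of_commute {L : Set V} {h : RACG Γ.Adj} (hh : h ∈ parabolic Γ.Adj L)
    (hinf : ¬ IsOfFinOrder h) (T : Finset V) {g : RACG Γ.Adj} (hgT : g ∈ parabolic Γ.Adj T)
    (hgL : g ∉ parabolic Γ.Adj L) (hc : Commute g h) :
    ∃ u ∈ T, u ∉ L ∧ ∃ p ∈ L ∩ Γ.neighborSet u, ∃ q ∈ L ∩ Γ.neighborSet u, p ≠ q ∧ ¬ Γ.Adj p q := by
  classical
  induction T using Finset.strongInduction with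
  | H T ih =>
  by_cases hTL : (T : Set V) ⊆ L
  · exact absurd (parabolic_mono hTL hgT) hgL
  obtain ⟨u, huT, huL⟩ := Set.not_subset.1 hTL
  rw [Finset.mem_coe] at huT
  by_cases hf : (split Γ u g).left = 1
  · have hg : g = retract {u}ᶜ g := by
      conv_lhs => rw [← unsplit_split (v := u) g,
        ← SemidirectProduct.inl_left_mul_inr_right (split Γ u g), hf, map_one, one_mul]
      rw [unsplit, SemidirectProduct.lift_inr, MonoidHom.comp_apply, MonoidHom.coe_fst,
        split_right_fst, retract_retract, Set.inter_self]
    have hgT' : g ∈ parabolic Γ.Adj (T.erase u : Finset V) := by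
      rw [hg]
      refine parabolic_mono ?_ (retract_mem_inter hgT)
      intro s hs
      simpa [and_comm] using hs
    obtain ⟨w, hw, H⟩ := ih _ (Finset.erase_ssubset huT) hgT'
    exact ⟨w, Finset.mem_of_mem_erase hw, H⟩
  · have hh' : h ∈ parabolic Γ.Adj {u}ᶜ :=
      parabolic_mono (Set.subset_compl_singleton_iff.2 huL) hh
    have hfix : FreeGroup.map (MulAction.toPerm h) (split Γ u g).left = (split Γ u g).left := by
      have := congrArg SemidirectProduct.left (hc.map (split Γ u)).eq
      rw [split_of_mem_parabolic hh'] at this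
      simpa [cosetAut_one] using this.symm
    obtain ⟨J, N, c, hN, hJ, hJN⟩ := FreeGroup.exists_pow_fixes_of_isConj _ _
      (isConj_iff.2 ⟨1, by simpa using hfix⟩ :
        IsConj (FreeGroup.map (MulAction.toPerm h) (split Γ u g).left) (split Γ u g).left)
    have hne : J.Nonempty := by
      by_contra hne
      rw [Finset.not_nonempty_iff_eq_empty.1 hne, Finset.coe_empty, FreeGroup.retract_empty,
        eq_comm, conj_eq_one_iff] at hJ
      exact hf hJ
    obtain ⟨i, hi⟩ := hne
    obtain ⟨a, rfl⟩ := QuotientGroup.mk_surjective i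
    have hfa := hJN _ hi
    rw [← MulAction.toPermHom_apply, ← map_pow, MulAction.toPermHom_apply,
      MulAction.toPerm_apply] at hfa
    have hmem := retract_mem_inter (J := L) (conj_mem_parabolic_of_smul_eq (pow_mem hh' N) hfa)
    rw [map_mul, map_mul, map_inv, map_pow, mem_parabolic.1 hh] at hmem
    exact ⟨u, huT, huL, exists_not_adj_of_not_isOfFinOrder hmem
      (not_isOfFinOrder_conj_pow hinf hN.ne' _)⟩

variable (Γ) in
/-- The graph has an induced four-cycle, with diagonals `{v, u}` and `{p, q}`. -/
def HasInducedSquare : Prop :=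
  ∃ v u p q, v ≠ u ∧ ¬ Γ.Adj v u ∧ p ≠ q ∧ ¬ Γ.Adj p q ∧
    Γ.Adj v p ∧ Γ.Adj v q ∧ Γ.Adj u p ∧ Γ.Adj u q

lemma hasInducedSquare_of_conj_mem [Finite V] {v : V} {h a b : RACG Γ.Adj}
    (hinf : ¬ IsOfFinOrder h) (ha : a ∈ parabolic Γ.Adj {v}ᶜ) (hb : b ∈ parabolic Γ.Adj {v}ᶜ)
    (hab : a⁻¹ * b ∉ parabolic Γ.Adj (Γ.neighborSet v))
    (hha : a⁻¹ * h * a ∈ parabolic Γ.Adj (Γ.neighborSet v))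
    (hhb : b⁻¹ * h * b ∈ parabolic Γ.Adj (Γ.neighborSet v)) : HasInducedSquare Γ := by
  classical
  have := Fintype.ofFinite V
  let ρ := retract (adj := Γ.Adj) (Γ.neighborSet v)
  have hsub : parabolic Γ.Adj (Γ.neighborSet v) ≤ parabolic Γ.Adj {v}ᶜ :=
    parabolic_mono neighborSet_subset_compl
  set g := a⁻¹ * b with hg
  have hρ : ρ g ∈ parabolic Γ.Adj (Γ.neighborSet v) := retract_mem_parabolic _ _
  have hrel : a⁻¹ * h * a * g = g * (b⁻¹ * h * b) := by rw [hg]; group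
  have hρrel : a⁻¹ * h * a * ρ g = ρ g * (b⁻¹ * h * b) := by
    have := congrArg ρ hrel
    rwa [map_mul ρ, map_mul ρ g, mem_parabolic.1 hha, mem_parabolic.1 hhb] at this
  have hcomm : Commute (g * (ρ g)⁻¹) (a⁻¹ * h * a) := by
    have h1 : (ρ g)⁻¹ * (a⁻¹ * h * a) = b⁻¹ * h * b * (ρ g)⁻¹ := by
      rw [inv_mul_eq_iff_eq_mul, ← mul_assoc, eq_mul_inv_iff_mul_eq, hρrel]
    rw [Commute, SemiconjBy, mul_assoc, h1, ← mul_assoc, ← hrel, mul_assoc]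
  have hconj : ¬ IsOfFinOrder (a⁻¹ * h * a) := by
    simpa using not_isOfFinOrder_conj_pow hinf one_ne_zero a
  obtain ⟨u, hu, huL, p, hp, q, hq, hpq, hadj⟩ := exists_link_of_commute hha hconj
    ({v}ᶜ : Finset V) (g := g * (ρ g)⁻¹)
    (by
      rw [Finset.coe_compl, Finset.coe_singleton]
      exact mul_mem (mul_mem (inv_mem ha) hb) (inv_mem (hsub hρ)))
    (fun hmem ↦ hab (by simpa using mul_mem hmem hρ)) hcomm
  exact ⟨v, u, p, q, by simpa [eq_comm] using hu, huL, hpq, hadj, hp.1, hq.1, hp.2, hq.2⟩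

lemma hasInducedSquare_of_split_right_eq_one [Finite V] (v : V) {f w : RACG Γ.Adj}
    (hc : Commute f w) (hi : IsIndepPair f w) (hf : (split Γ v f).right = 1) :
    HasInducedSquare Γ := by
  have hf0 : split Γ v f = SemidirectProduct.inl (split Γ v f).left := by
    ext <;> simp [hf]
  have hright : ∀ z : RACG Γ.Adj, (split Γ v (z ^ 2)).right = (retract {v}ᶜ z ^ 2, 1) := fun z ↦ by
    ext
    · rw [split_right_fst, map_pow]
    · simp [pow_two]
  by_cases hfin : IsOfFinOrder (retract {v}ᶜ w)
  · obtain ⟨n, hn, hwn⟩ := isOfFinOrder_iff_pow_eq_one.1 hfin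
    have hw0 : split Γ v ((w ^ n) ^ 2) = SemidirectProduct.inl (split Γ v ((w ^ n) ^ 2)).left := by
      have h1 : (split Γ v ((w ^ n) ^ 2)).right = 1 := by rw [hright, map_pow, hwn, one_pow]; rfl
      ext <;> simp only [h1, SemidirectProduct.left_inl, SemidirectProduct.right_inl]
    have hc' : Commute f ((w ^ n) ^ 2) := (hc.pow_right n).pow_right 2
    have hi' : IsIndepPair f ((w ^ n) ^ 2) := by
      simpa [pow_mul] using hi.pow one_ne_zero (mul_ne_zero hn.ne' two_ne_zero)
    refine (FreeGroup.not_isIndepPair_of_commute (f := (split Γ v f).left)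
      (g := (split Γ v ((w ^ n) ^ 2)).left) ?_ ?_).elim
    · have := (hc'.map (split Γ v)).eq
      rw [hf0, hw0, ← map_mul, ← map_mul] at this
      exact SemidirectProduct.inl_injective this
    · intro a b hab
      refine hi' a b (split_injective (v := v) ?_)
      rw [map_mul, map_zpow, map_zpow, hf0, hw0, ← map_zpow, ← map_zpow, ← map_mul, map_one]
      rw [hab, map_one]
  · set h := retract {v}ᶜ w ^ 2 with hh_def
    have hinf : ¬ IsOfFinOrder h := fun H ↦ hfin (H.of_pow two_ne_zero)
    have hh : h ∈ parabolic Γ.Adj {v}ᶜ := pow_mem (retract_mem_parabolic _ _) 2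
    have hconj : IsConj (FreeGroup.map (MulAction.toPerm h) (split Γ v f).left)
        (split Γ v f).left := by
      have := congrArg SemidirectProduct.left ((hc.pow_right 2).map (split Γ v)).eq
      rw [SemidirectProduct.mul_left, SemidirectProduct.mul_left, hf, hright, ← hh_def, map_one,
        MulAut.one_apply, cosetAut_one] at this
      exact isConj_iff.2 ⟨_, mul_inv_eq_iff_eq_mul.2 this.symm⟩
    obtain ⟨J, N, c, hN, hJ, hJN⟩ := FreeGroup.exists_pow_fixes_of_isConj _ _ hconj
    have hcard : 1 < J.card := by
      by_contra! hcard
      have h1 := conjHom_retract_mul_self hcard (c * (split Γ v f).left * c⁻¹)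
      have h2 : conjHom Γ v (split Γ v f).left = f := by
        conv_rhs => rw [← unsplit_split (v := v) f, hf0, unsplit, SemidirectProduct.lift_inl]
      rw [hJ, map_mul, map_mul, map_inv, conj_pow, conj_eq_one_iff, h2] at h1
      exact hi.not_isOfFinOrder_left (isOfFinOrder_iff_pow_eq_one.2 ⟨2, two_pos, h1⟩)
    obtain ⟨i, hi, j, hj, hij⟩ := Finset.one_lt_card.1 hcard
    obtain ⟨a, rfl⟩ := QuotientGroup.mk_surjective i
    obtain ⟨b, rfl⟩ := QuotientGroup.mk_surjective j
    have hmem : ∀ d : RACG Γ.Adj, (d : RACG Γ.Adj ⧸ linkPreimage Γ v) ∈ J →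
        (retract {v}ᶜ d)⁻¹ * h ^ N * retract {v}ᶜ d ∈ parabolic Γ.Adj (Γ.neighborSet v) := by
      intro d hd
      have hfd := hJN _ hd
      rw [← MulAction.toPermHom_apply, ← map_pow, MulAction.toPermHom_apply,
        MulAction.toPerm_apply] at hfd
      exact conj_mem_parabolic_of_smul_eq (pow_mem hh N) hfd
    refine hasInducedSquare_of_conj_mem (fun H ↦ hinf (H.of_pow hN.ne'))
      (retract_mem_parabolic _ a) (retract_mem_parabolic _ b) (fun H ↦ hij ?_)
      (hmem a hi) (hmem b hj)
    rw [QuotientGroup.eq, mem_linkPreimage, map_mul, map_inv]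
    exact H

/-- If a right-angled Coxeter group contains a free abelian group of rank two, then its defining
graph contains an induced square. -/
lemma hasInducedSquare_of_isIndepPair [Finite V] {x y : RACG Γ.Adj} (hc : Commute x y)
    (hi : IsIndepPair x y) : HasInducedSquare Γ := by
  classical
  have := Fintype.ofFinite V
  suffices ∀ (T : Finset V) (x y : RACG Γ.Adj), Commute x y → IsIndepPair x y →
      x ∈ parabolic Γ.Adj T → y ∈ parabolic Γ.Adj T → HasInducedSquare Γ from
    this Finset.univ x y hc hi (by simpa using mem_parabolic_univ x)
      (by simpa using mem_parabolic_univ y)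
  intro T
  induction T using Finset.induction_on with
  | empty =>
    intro x y _ hi hx _
    rw [Finset.coe_empty] at hx
    exact absurd (mem_parabolic_empty hx) hi.left_ne_one
  | insert v T hv ih =>
    intro x y hc hi hx hy
    by_cases hi' : IsIndepPair (retract {v}ᶜ x) (retract {v}ᶜ y)
    · have hsub : {v}ᶜ ∩ ((insert v T : Finset V) : Set V) ⊆ T := by
        rintro s ⟨hs, hsT⟩
        exact Finset.mem_of_mem_insert_of_ne hsT hs
      exact ih _ _ (hc.map _) hi' (parabolic_mono hsub (retract_mem_inter hx))
        (parabolic_mono hsub (retract_mem_inter hy))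
    · simp only [IsIndepPair, not_forall] at hi'
      obtain ⟨a, b, hab, hne⟩ := hi'
      have hright : (split Γ v ((x ^ a * y ^ b) ^ 2)).right = 1 := by
        ext
        · rw [split_right_fst, map_pow, map_mul, map_zpow, map_zpow, hab, one_pow]
          rfl
        · simp [pow_two]
      by_cases ha : a = 0
      · have hb : b ≠ 0 := fun hb ↦ hne ⟨ha, hb⟩
        rw [(hc.zpow_zpow a b).eq] at hright
        refine hasInducedSquare_of_split_right_eq_one v (w := x) ?_ ?_ hright
        · exact ((hc.symm.zpow_left b).mul_left ((Commute.refl x).zpow_left a)).pow_left 2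
        · simpa using ((hi.symm hc).mul_zpow_left hc.symm hb a).pow two_ne_zero one_ne_zero
      · refine hasInducedSquare_of_split_right_eq_one v (w := y) ?_ ?_ hright
        · exact ((hc.zpow_left a).mul_left ((Commute.refl y).zpow_left b)).pow_left 2
        · simpa using (hi.mul_zpow_left hc ha b).pow two_ne_zero one_ne_zero

end Square

section Dihedral

variable {V : Type} {Γ : SimpleGraph V} {u v : V}

open Classical in
/-- The map onto the infinite dihedral group determined by two distinct non-adjacent vertices. -/
noncomputable def toDihedral (hadj : ¬ Γ.Adj v u) : RACG Γ.Adj →* DihedralGroup 0 :=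
  lift (fun s ↦ if s = v then .sr 0 else if s = u then .sr 1 else 1)
    (fun s ↦ by split_ifs <;> simp)
    (fun s t hst ↦ by
      split_ifs with h1 h2 h3 h4 h5 h6 <;> try simp
      · subst h1 h3; exact absurd hst hadj
      · subst h4 h5; exact absurd hst.symm hadj)

lemma toDihedral_gen_of_ne (hadj : ¬ Γ.Adj v u) {s : V} (hv : s ≠ v) (hu : s ≠ u) :
    toDihedral hadj (racgGen Γ.Adj s) = 1 := by
  simp [toDihedral, hv, hu]

lemma toDihedral_gen_mul_gen_zpow (hadj : ¬ Γ.Adj v u) (hne : v ≠ u) (a : ℤ) :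
    toDihedral hadj ((racgGen Γ.Adj v * racgGen Γ.Adj u) ^ a) = .r a := by
  simp only [toDihedral, map_zpow, map_mul, lift_gen, hne.symm, if_true, if_false,
    DihedralGroup.sr_mul_sr, sub_zero, DihedralGroup.r_one_zpow]
  exact congrArg _ Int.cast_id

lemma zpow_gen_mul_gen_eq_one (hadj : ¬ Γ.Adj v u) (hne : v ≠ u) {a : ℤ}
    (ha : (racgGen Γ.Adj v * racgGen Γ.Adj u) ^ a = 1) : a = 0 := by
  have := congrArg (toDihedral hadj) ha
  rw [toDihedral_gen_mul_gen_zpow hadj hne, map_one, DihedralGroup.one_def] at this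
  exact DihedralGroup.r.inj this

lemma racgLength_wordProd_pair (hadj : ¬ Γ.Adj v u) (hne : v ≠ u) :
    racgLength Γ.Adj (wordProd Γ.Adj [v, u]) = [v, u].length := by
  refine le_antisymm (Nat.sInf_le ⟨[v, u], rfl, rfl⟩) (le_csInf ⟨_, [v, u], rfl, rfl⟩ ?_)
  rintro _ ⟨l, rfl, hl⟩
  by_contra! hlt
  have hsq : wordProd Γ.Adj l ^ (2 : ℤ) = 1 := by
    rcases l with _ | ⟨s, _ | ⟨t, l⟩⟩
    · simp [wordProd]
    · rw [zpow_two]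
      simpa [wordProd] using gen_mul_self s
    · simp at hlt
  rw [hl] at hsq
  simp only [wordProd, List.map_cons, List.map_nil, List.prod_cons, List.prod_nil, mul_one] at hsq
  exact two_ne_zero (zpow_gen_mul_gen_eq_one hadj hne hsq)

end Dihedral

end RACG

/-- If `x, y` generate a subgroup of the right-angled Coxeter group of a finite simple
graph isomorphic to `ℤ × ℤ`, then there exist reduced words `x' = s₁⋯sₘ`, `y' = t₁⋯tₙ`
generating a rank-two free abelian subgroup such that every letter `tᵢ` commutes with
every letter `sⱼ`. -/
theorem racg_Z2_good_generators {V : Type} [Fintype V] (Γ : SimpleGraph V)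
    (x y : RACG Γ.Adj) (hc : Commute x y)
    (hfree : ∀ a b : ℤ, x ^ a * y ^ b = 1 → a = 0 ∧ b = 0) :
    ∃ l₁ l₂ : List V,
      racgLength Γ.Adj (wordProd Γ.Adj l₁) = l₁.length ∧
      racgLength Γ.Adj (wordProd Γ.Adj l₂) = l₂.length ∧
      (∀ s ∈ l₁, ∀ t ∈ l₂, Commute (racgGen Γ.Adj s) (racgGen Γ.Adj t)) ∧
      Commute (wordProd Γ.Adj l₁) (wordProd Γ.Adj l₂) ∧
      (∀ a b : ℤ, (wordProd Γ.Adj l₁) ^ a * (wordProd Γ.Adj l₂) ^ b = 1 →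
        a = 0 ∧ b = 0) := by
  obtain ⟨v, u, p, q, hvu, hadj, hpq, hadj', hvp, hvq, hup, huq⟩ :=
    RACG.hasInducedSquare_of_isIndepPair hc hfree
  have hcomm : ∀ s ∈ [v, u], ∀ t ∈ [p, q], Commute (racgGen Γ.Adj s) (racgGen Γ.Adj t) := by
    simp [RACG.gen_commute hvp, RACG.gen_commute hvq, RACG.gen_commute hup, RACG.gen_commute huq]
  refine ⟨[v, u], [p, q], RACG.racgLength_wordProd_pair hadj hvu,
    RACG.racgLength_wordProd_pair hadj' hpq, hcomm, ?_, fun a b hab ↦ ?_⟩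
  · simp only [List.mem_cons, List.not_mem_nil, or_false, forall_eq_or_imp, forall_eq] at hcomm
    simp only [wordProd, List.map_cons, List.map_nil, List.prod_cons, List.prod_nil, mul_one]
    exact (hcomm.1.1.mul_right hcomm.1.2).mul_left (hcomm.2.1.mul_right hcomm.2.2)
  · simp only [wordProd, List.map_cons, List.map_nil, List.prod_cons, List.prod_nil,
      mul_one] at hab
    have ha : a = 0 := by
      have := congrArg (RACG.toDihedral hadj) hab
      rw [map_mul, RACG.toDihedral_gen_mul_gen_zpow hadj hvu, map_zpow, map_mul,
        RACG.toDihedral_gen_of_ne hadj hvp.ne' hup.ne',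
        RACG.toDihedral_gen_of_ne hadj hvq.ne' huq.ne', one_mul, one_zpow, mul_one, map_one,
        DihedralGroup.one_def] at this
      exact DihedralGroup.r.inj this
    subst ha
    rw [zpow_zero, one_mul] at hab
    exact ⟨rfl, RACG.zpow_gen_mul_gen_eq_one hadj' hpq hab⟩
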